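/- arXiv:2301.01890 — 2 statements merged into one kernel-verified Lean document; each statement's English description precedes it below -/
import Mathlib

section
/- Let A = (Q, δ, I, F) be a complete elevator automaton (every accepting SCC is inherently weak or deterministic) in which every accepting transition has both endpoints in a single SCC. Let Q_W be the union of the accepting inherently weak SCCs of A and Q_D the union of the accepting deterministic SCCs that are not inherently weak, and write F_D for the set of accepting transitions with both endpoints in Q_D and δ_{F_D}(S,a) = {q | ∃p ∈ S, (p,a,q) ∈ F_D}. Let E be the TELA with states 2^Q × (2^{Q_D} × 2^{Q_D} × 2^{Q_D}) × (2^{Q_W} × 2^{Q_W}), colours {0, 1}, acceptance Inf 0 ∧ Inf 1, initial state (I, (I ∩ Q_D, ∅, I ∩ Q_D), (I ∩ Q_W, I ∩ Q_W)), and the following transitions from (H, (C_D, S_D, B_D), (C_W, B_W)) over a ∈ Σ: there is no transition if δ_{F_D}(S_D,a) ≠ ∅; otherwise the first component updates to δ(H,a); the deterministic-block component updates with S_D' = δ_SCC(S_D,a) ∩ Q_D, C_D' = (δ(H,a) ∩ Q_D) \ S_D', B_D* = δ_SCC(B_D,a), and B_D' = C_D' emitting colour 0 if B_D* = ∅ and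 B_D' = B_D* emitting no colour otherwise, with an additional alternative successor (C_D'', S_D'', C_D'') emitting colour 0, where S_D'' = S_D' ∪ B_D' and C_D'' = C_D' \ S_D'', available whenever δ_{F_D}(B_D,a) ∩ δ_SCC(B_D,a) = ∅; the weak-block component updates deterministically with C_W' = δ(H,a) ∩ Q_W, B_W* = δ(B_W,a) ∩ C_W', and B_W' = C_W' emitting colour 1 if B_W* = ∅ and B_W' = B_W* emitting no colour otherwise; each transition carries exactly the set of colours emitted by its components. Then L(E) = Σ^ω \ L(A). -/
attribute [local instance] Classical.propDecidable

universe u v w y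

/-- Emerson–Lei acceptance conditions over colours `γ`. -/
inductive EL (γ : Type u) : Type u
  | inf : γ → EL γ
  | fin : γ → EL γ
  | conj : EL γ → EL γ → EL γ
  | disj : EL γ → EL γ → EL γ

/-- Satisfaction of an Emerson–Lei condition by a set `M` of colours. -/
def EL.sat {γ : Type u} (M : Set γ) : EL γ → Prop
  | .inf c => c ∈ M
  | .fin c => c ∉ M
  | .conj φ ψ => φ.sat M ∧ ψ.sat M
  | .disj φ ψ => φ.sat M ∨ ψ.sat M

/-- Renaming of colours in an Emerson–Lei condition. -/
def EL.map {γ : Type u} {γ' : Type v} (f : γ → γ') : EL γ → EL γ'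
  | .inf c => .inf (f c)
  | .fin c => .fin (f c)
  | .conj φ ψ => .conj (φ.map f) (ψ.map f)
  | .disj φ ψ => .disj (φ.map f) (ψ.map f)

/-- A (transition-based) Büchi automaton over alphabet `A` with states `Q`. -/
structure BA (Q : Type u) (A : Type v) where
  delta : Set (Q × A × Q)
  init : Set Q
  F : Set (Q × A × Q)
  F_sub : F ⊆ delta

namespace BA

variable {Q : Type u} {A : Type v}

/-- `δ(S, a)`. -/
def deltaSet (M : BA Q A) (S : Set Q) (a : A) : Set Q :=
  {q | ∃ p ∈ S, (p, a, q) ∈ M.delta}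

/-- `δ_F(S, a)`. -/
def deltaF (M : BA Q A) (S : Set Q) (a : A) : Set Q :=
  {q | ∃ p ∈ S, (p, a, q) ∈ M.F}

/-- `δ(S, u)` for a finite word `u`. -/
def deltaWord (M : BA Q A) (S : Set Q) : List A → Set Q
  | [] => S
  | a :: u => M.deltaWord (M.deltaSet S a) u

/-- A run of the BA on an infinite word. -/
def IsRun (M : BA Q A) (w : ℕ → A) (ρ : ℕ → Q) : Prop :=
  ρ 0 ∈ M.init ∧ ∀ i, (ρ i, w i, ρ (i + 1)) ∈ M.delta

/-- An accepting run of the BA on an infinite word. -/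
def AccRun (M : BA Q A) (w : ℕ → A) (ρ : ℕ → Q) : Prop :=
  M.IsRun w ρ ∧ {i | (ρ i, w i, ρ (i + 1)) ∈ M.F}.Infinite

/-- The language of the BA. -/
def lang (M : BA Q A) : Set (ℕ → A) := {w | ∃ ρ, M.AccRun w ρ}

/-- Completeness of a BA. -/
def Complete (M : BA Q A) : Prop :=
  M.init.Nonempty ∧ ∀ q a, ∃ q', (q, a, q') ∈ M.delta

/-- One transition step (over some symbol). -/
def Step (M : BA Q A) (p q : Q) : Prop := ∃ a, (p, a, q) ∈ M.delta

/-- Reachability. -/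
def Reach (M : BA Q A) : Q → Q → Prop := Relation.ReflTransGen M.Step

/-- Mutual reachability, i.e., lying in the same SCC. -/
def SameSCC (M : BA Q A) (p q : Q) : Prop := M.Reach p q ∧ M.Reach q p

/-- A strongly connected component: a maximal nonempty set of pairwise
mutually reachable states. -/
def IsSCC (M : BA Q A) (C : Set Q) : Prop :=
  C.Nonempty ∧ (∀ p ∈ C, ∀ q ∈ C, M.Reach p q) ∧
    ∀ D, C ⊆ D → (∀ p ∈ D, ∀ q ∈ D, M.Reach p q) → D ⊆ C

/-- An accepting SCC: one containing an accepting transition with both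
endpoints in it. -/
def IsAccSCC (M : BA Q A) (C : Set Q) : Prop :=
  M.IsSCC C ∧ ∃ p ∈ C, ∃ a, ∃ q ∈ C, (p, a, q) ∈ M.F

/-- `δ_SCC(S, a)`: restriction of `δ` to transitions staying in one SCC. -/
def deltaSCC (M : BA Q A) (S : Set Q) (a : A) : Set Q :=
  {q | ∃ p ∈ S, (p, a, q) ∈ M.delta ∧ M.SameSCC p q}

/-- A cycle of length `k > 0` lying inside the set `C`. -/
def IsCycleIn (M : BA Q A) (C : Set Q) (k : ℕ) (ρ : ℕ → Q) (σ : ℕ → A) : Prop :=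
  0 < k ∧ ρ 0 = ρ k ∧ ∀ i < k, ρ i ∈ C ∧ (ρ i, σ i, ρ (i + 1)) ∈ M.delta

/-- `C` is inherently weak: every cycle inside `C` contains an accepting
transition, or no cycle inside `C` contains one. -/
def InherentlyWeak (M : BA Q A) (C : Set Q) : Prop :=
  (∀ k ρ σ, M.IsCycleIn C k ρ σ → ∃ i < k, (ρ i, σ i, ρ (i + 1)) ∈ M.F) ∨
  (∀ k ρ σ, M.IsCycleIn C k ρ σ → ∀ i < k, (ρ i, σ i, ρ (i + 1)) ∉ M.F)

/-- `C` is a deterministic SCC. -/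
def DetSCC (M : BA Q A) (C : Set Q) : Prop :=
  ∀ q ∈ C, ∀ a : A, (M.deltaSet {q} a ∩ C).Subsingleton

/-- A partition block: a nonempty union of accepting SCCs. -/
def IsPartitionBlock (M : BA Q A) (P : Set Q) : Prop :=
  P.Nonempty ∧ ∃ Cs : Set (Set Q), (∀ C ∈ Cs, M.IsAccSCC C) ∧ P = ⋃₀ Cs

/-- `A_P`: accepting transitions restricted to those between states of `P`. -/
def restrict (M : BA Q A) (P : Set Q) : BA Q A where
  delta := M.delta
  init := M.init
  F := M.F ∩ {t | t.1 ∈ P ∧ t.2.2 ∈ P}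
  F_sub := fun _ ht => M.F_sub ht.1

end BA

/-- A partitioning of a BA: pairwise disjoint partition blocks containing
all accepting SCCs. -/
def IsPartitioning {Q : Type u} {A : Type v} {n : ℕ} (M : BA Q A)
    (P : Fin n → Set Q) : Prop :=
  (∀ i, M.IsPartitionBlock (P i)) ∧
  (Pairwise fun i j => Disjoint (P i) (P j)) ∧
  ∀ C, M.IsAccSCC C → ∃ i, C ⊆ P i

/-- A transition-based Emerson–Lei automaton; transitions carry sets of
colours. -/
structure TELA (Q : Type u) (A : Type v) (γ : Type w) where
  trans : Set (Q × A × Set γ × Q)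
  init : Set Q
  acc : EL γ

namespace TELA

variable {Q : Type u} {A : Type v} {γ : Type w}

/-- A run of the TELA (state sequence together with emitted colour sets). -/
def IsRun (T : TELA Q A γ) (w : ℕ → A) (ρ : ℕ → Q) (κ : ℕ → Set γ) : Prop :=
  ρ 0 ∈ T.init ∧ ∀ i, (ρ i, w i, κ i, ρ (i + 1)) ∈ T.trans

/-- The union of colour sets of transitions occurring infinitely often. -/
def infCols (w : ℕ → A) (ρ : ℕ → Q) (κ : ℕ → Set γ) : Set γ :=
  {c | ∃ t : Q × A × Set γ × Q,
    {i | (ρ i, w i, κ i, ρ (i + 1)) = t}.Infinite ∧ c ∈ t.2.2.1}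

/-- An accepting run of the TELA. -/
def AccRun (T : TELA Q A γ) (w : ℕ → A) (ρ : ℕ → Q) (κ : ℕ → Set γ) : Prop :=
  T.IsRun w ρ κ ∧ EL.sat (infCols w ρ κ) T.acc

/-- The language of the TELA. -/
def lang (T : TELA Q A γ) : Set (ℕ → A) := {w | ∃ ρ κ, T.AccRun w ρ κ}

end TELA

/-- A partial complementation instance for a partition block. -/
structure PartialAlg (Q : Type u) (A : Type v) (T : Type w) (γ : Type y) where
  init : Set T
  succ : Set Q → T → A → Set (T × Set γ)
  acc : EL γ

/-- `ModCompl` for a single partial complementation instance. -/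
def ModCompl1 {Q : Type u} {A : Type v} {T : Type w} {γ : Type y}
    (M : BA Q A) (alg : PartialAlg Q A T γ) : TELA (Set Q × T) A γ where
  init := {x | x.1 = M.init ∧ x.2 ∈ alg.init}
  trans := {x | ∃ H m a m' α, (m', α) ∈ alg.succ H m a ∧
    x = ((H, m), a, α, (M.deltaSet H a, m'))}
  acc := alg.acc

/-- Conjunction of a nonempty family of Emerson–Lei conditions. -/
def ELbigAnd {γ : Type u} {n : ℕ} (f : Fin (n + 1) → EL γ) : EL γ :=
  List.foldl EL.conj (f 0) (List.ofFn fun i : Fin n => f i.succ)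

/-- The synchronous modular complementation `ModCompl` for several partial
complementation instances; colours are renumbered via `Sigma.mk`. -/
def ModComplN {Q : Type u} {A : Type v} {n : ℕ} {T : Fin (n + 1) → Type w}
    {γ : Fin (n + 1) → Type y} (M : BA Q A)
    (alg : ∀ i, PartialAlg Q A (T i) (γ i)) :
    TELA (Set Q × (∀ i, T i)) A (Σ i, γ i) where
  init := {x | x.1 = M.init ∧ ∀ i, x.2 i ∈ (alg i).init}
  trans := {x | ∃ (H : Set Q) (m : ∀ i, T i) (a : A) (m' : ∀ i, T i)
      (α : ∀ i, Set (γ i)),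
    (∀ i, (m' i, α i) ∈ (alg i).succ H (m i) a) ∧
    x = ((H, m), a, {c : Σ i, γ i | c.2 ∈ α c.1}, (M.deltaSet H a, m'))}
  acc := ELbigAnd fun i => ((alg i).acc).map (Sigma.mk i)

/-- A partial round-robin complementation instance. -/
structure RRAlg (Q : Type u) (A : Type v) (Tt Ta : Type w) (γ : Type y) where
  init : Set Tt
  succT : Set Q → Tt → A → Set (Tt × Set γ)
  succA : Set Q → Ta → A → Set ((Tt ⊕ Ta) × Set γ)
  lift : Tt → Set Ta
  acc : EL γ

/-- The flattening `algunion` of a partial round-robin instance. -/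
def RRAlg.flatten {Q : Type u} {A : Type v} {Tt Ta : Type w} {γ : Type y}
    (R : RRAlg Q A Tt Ta γ) : PartialAlg Q A (Tt ⊕ Ta) γ where
  init := Sum.inl '' R.init
  succ := fun H m a =>
    match m with
    | Sum.inr mA => R.succA H mA a
    | Sum.inl mT =>
        {x | ∃ p ∈ R.succT H mT a, x = (Sum.inl p.1, p.2)} ∪
        {x | ∃ p ∈ R.succT H mT a, ∃ m'' ∈ R.lift p.1, x = (Sum.inr m'', p.2)}
  acc := R.acc

/-- Consistency (conditions (C1)–(C3)) of a partial round-robin instance with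
respect to a BA `B`. -/
def RRConsistent {Q : Type u} {A : Type v} {Tt Ta : Type w} {γ : Type y}
    (B : BA Q A) (R : RRAlg Q A Tt Ta γ) : Prop :=
  (∀ w ∈ (ModCompl1 B R.flatten).lang, ∃ ρ κ,
      (ModCompl1 B R.flatten).AccRun w ρ κ ∧
      {j | (ρ j).2.isRight = true ∧ ¬ (ρ (j + 1)).2.isRight = true}.Infinite) ∧
  (∀ w ρ κ, (ModCompl1 B R.flatten).AccRun w ρ κ → ∀ i : ℕ,
      (i = 0 ∨ (ρ (i - 1)).2.isLeft = true) →
      ((∃ ρ' κ', (ModCompl1 B R.flatten).AccRun w ρ' κ' ∧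
          (∀ j < i, ρ' j = ρ j) ∧ (ρ' i).2.isLeft = true) ∧
       (∃ ρ'' κ'', (ModCompl1 B R.flatten).AccRun w ρ'' κ'' ∧
          (∀ j < i, ρ'' j = ρ j) ∧ (ρ'' i).2.isRight = true))) ∧
  (∀ w ρ κ, (ModCompl1 B R.flatten).IsRun w ρ κ →
      {j | (ρ j).2.isRight = true ∧ ¬ (ρ (j + 1)).2.isRight = true}.Infinite →
      (ModCompl1 B R.flatten).AccRun w ρ κ)

/-- The union of the accepting inherently weak SCCs. -/
def BA.weakPart {Q A : Type} (M : BA Q A) : Set Q :=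
  {q | ∃ C, M.IsAccSCC C ∧ M.InherentlyWeak C ∧ q ∈ C}

/-- The union of the accepting deterministic SCCs that are not inherently
weak. -/
def BA.detPart {Q A : Type} (M : BA Q A) : Set Q :=
  {q | ∃ C, M.IsAccSCC C ∧ M.DetSCC C ∧ ¬ M.InherentlyWeak C ∧ q ∈ C}

/-- The accepting transitions with both endpoints in `detPart`. -/
def BA.FD {Q A : Type} (M : BA Q A) : Set (Q × A × Q) :=
  {t | t ∈ M.F ∧ t.1 ∈ M.detPart ∧ t.2.2 ∈ M.detPart}

/-- `δ_{F_D}(S, a)`. -/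
def BA.deltaFD {Q A : Type} (M : BA Q A) (S : Set Q) (a : A) : Set Q :=
  {q | ∃ p ∈ S, (p, a, q) ∈ M.FD}

/-- The synchronous complementation TELA for elevator automata, combining the
NCSB-style construction on the deterministic part with the breakpoint
construction on the inherently weak part. -/
def elevTELA {Q A : Type} (M : BA Q A) :
    TELA (Set Q × (Set Q × Set Q × Set Q) × (Set Q × Set Q)) A (Fin 2) where
  init := {(M.init, (M.init ∩ M.detPart, ∅, M.init ∩ M.detPart),
            (M.init ∩ M.weakPart, M.init ∩ M.weakPart))}
  trans := {x | ∃ (H CD SD BD CW BW : Set Q) (a : A)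
      (SD' CD' BDs BD' CW' BWs BW' : Set Q) (colD colW : Set (Fin 2)),
    M.deltaFD SD a = ∅ ∧
    SD' = M.deltaSCC SD a ∩ M.detPart ∧
    CD' = (M.deltaSet H a ∩ M.detPart) \ SD' ∧
    BDs = M.deltaSCC BD a ∧
    BD' = (if BDs = ∅ then CD' else BDs) ∧
    CW' = M.deltaSet H a ∩ M.weakPart ∧
    BWs = M.deltaSet BW a ∩ CW' ∧
    BW' = (if BWs = ∅ then CW' else BWs) ∧
    colW = (if BWs = ∅ then ({1} : Set (Fin 2)) else ∅) ∧
    ((colD = (if BDs = ∅ then ({0} : Set (Fin 2)) else ∅) ∧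
      x = ((H, (CD, SD, BD), (CW, BW)), a, colD ∪ colW,
           (M.deltaSet H a, (CD', SD', BD'), (CW', BW')))) ∨
     (M.deltaFD BD a ∩ M.deltaSCC BD a = ∅ ∧ colD = ({0} : Set (Fin 2)) ∧
      x = ((H, (CD, SD, BD), (CW, BW)), a, colD ∪ colW,
           (M.deltaSet H a,
            (CD' \ (SD' ∪ BD'), SD' ∪ BD', CD' \ (SD' ∪ BD')),
            (CW', BW')))))}
  acc := .conj (.inf 0) (.inf 1)

/-- Pigeonhole: if at every time some element of a finite type satisfies a predicate that gets
stronger with time, then one element satisfies it at all times. -/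
theorem exists_forall_of_forall_exists_antitone {α : Type*} [Finite α] {P : α → ℕ → Prop}
    (h : ∀ m, ∃ q, P q m) (hP : ∀ q m n, m ≤ n → P q n → P q m) : ∃ q, ∀ m, P q m := by
  by_contra! hc
  choose f hf using hc
  have := Fintype.ofFinite α
  obtain ⟨q, hq⟩ := h (Finset.univ.sup f)
  exact hf q (hP q _ _ (Finset.le_sup (Finset.mem_univ q)) hq)

/-- Kőnig's lemma for a time-dependent edge relation on a finite type. -/
theorem exists_path_of_nonempty_layers {α : Type*} [Finite α] (E : ℕ → α → α → Prop)
    (X : ℕ → Set α) (N : ℕ) (hne : ∀ n ≥ N, (X n).Nonempty)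
    (hX : ∀ n ≥ N, ∀ q ∈ X (n + 1), ∃ p ∈ X n, E n p q) :
    ∃ ρ : ℕ → α, ρ N ∈ X N ∧ ∀ i ≥ N, E i (ρ i) (ρ (i + 1)) := by
  let Path : α → ℕ → ℕ → Prop := fun q n m =>
    ∃ ρ : ℕ → α, ρ n = q ∧ ∀ i, n ≤ i → i < m → E i (ρ i) (ρ (i + 1))
  have hback : ∀ d, ∀ q ∈ X (N + d), ∃ ρ : ℕ → α, ρ N ∈ X N ∧ ρ (N + d) = q ∧
      ∀ i, N ≤ i → i < N + d → E i (ρ i) (ρ (i + 1)) := by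
    intro d
    induction d with
    | zero => exact fun q hq => ⟨fun _ => q, hq, rfl, fun i h1 h2 => by omega⟩
    | succ d ih =>
      intro q hq
      obtain ⟨p, hp, hpq⟩ := hX (N + d) (by omega) q hq
      obtain ⟨ρ, h0, h1, h2⟩ := ih p hp
      refine ⟨Function.update ρ (N + d + 1) q, ?_, ?_, ?_⟩
      · rwa [Function.update_of_ne (by omega)]
      · exact Function.update_self ..
      · intro i hi hi'
        rw [Function.update_of_ne (by omega)]
        by_cases hid : i = N + d
        · subst hid; rw [Function.update_self, h1]; exact hpq
        · rw [Function.update_of_ne (by omega)]; exact h2 i hi (by omega)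
  obtain ⟨q₀, hq₀⟩ : ∃ q, ∀ m, q ∈ X N ∧ Path q N m := by
    refine exists_forall_of_forall_exists_antitone (fun m => ?_) ?_
    · obtain ⟨q, hq⟩ := hne (N + m) (by omega)
      obtain ⟨ρ, h0, -, h2⟩ := hback m q hq
      exact ⟨ρ N, h0, ρ, rfl, fun i h h' => h2 i h (by omega)⟩
    · rintro q m n hmn ⟨hq, ρ, h0, h1⟩
      exact ⟨hq, ρ, h0, fun i h h' => h1 i h (by omega)⟩
  have hstep : ∀ n q, (∀ m, Path q n m) → ∃ q', E n q q' ∧ ∀ m, Path q' (n + 1) m := by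
    intro n q hq
    have : ∃ q', ∀ m, E n q q' ∧ Path q' (n + 1) m := by
      refine exists_forall_of_forall_exists_antitone (fun m => ?_) ?_
      · obtain ⟨ρ, h0, h1⟩ := hq (n + 1 + m)
        refine ⟨ρ (n + 1), ?_, ρ, rfl, fun i h h' => h1 i (by omega) (by omega)⟩
        have := h1 n le_rfl (by omega)
        rwa [h0] at this
      · rintro q m n hmn ⟨hq, ρ, h0, h1⟩
        exact ⟨hq, ρ, h0, fun i h h' => h1 i h (by omega)⟩
    obtain ⟨q', h⟩ := this
    exact ⟨q', (h 0).1, fun m => (h m).2⟩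
  choose! nxt hE hG using hstep
  let σ : ℕ → α := fun d => Nat.rec q₀ (fun d q => nxt (N + d) q) d
  have hσ : ∀ d m, Path (σ d) (N + d) m := by
    intro d
    induction d with
    | zero => exact fun m => (hq₀ m).2
    | succ d ih => exact hG (N + d) (σ d) ih
  refine ⟨fun i => σ (i - N), by simpa [σ] using (hq₀ 0).1, fun i hi => ?_⟩
  obtain ⟨d, rfl⟩ := Nat.exists_eq_add_of_le hi
  have h := hE (N + d) (σ d) (hσ d)
  have e1 : N + d - N = d := by omega
  have e2 : N + d + 1 - N = d + 1 := by omega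
  simp only [e1, e2]
  exact h

theorem Set.infinite_setOf_of_forall_exists_ge {P : ℕ → Prop} (h : ∀ n, ∃ i ≥ n, P i) :
    {i | P i}.Infinite :=
  Set.infinite_of_forall_exists_gt fun n => by
    obtain ⟨i, hi, hP⟩ := h (n + 1)
    exact ⟨i, hP, by omega⟩

theorem Set.Infinite.exists_ge_of_setOf {P : ℕ → Prop} (h : {i | P i}.Infinite) (n : ℕ) :
    ∃ i ≥ n, P i := by
  obtain ⟨i, hi, hn⟩ := h.exists_gt n
  exact ⟨i, hn.le, hi⟩

theorem TELA.mem_infCols_iff {Q A γ : Type} [Finite Q] [Finite A] [Finite γ] (w : ℕ → A)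
    (ρ : ℕ → Q) (κ : ℕ → Set γ) (c : γ) :
    c ∈ TELA.infCols w ρ κ ↔ ∀ n, ∃ i ≥ n, c ∈ κ i := by
  constructor
  · rintro ⟨t, ht, hc⟩ n
    obtain ⟨i, hi, rfl⟩ := ht.exists_ge_of_setOf n
    exact ⟨i, hi, hc⟩
  · intro h
    obtain ⟨t, ht⟩ : ∃ t : Q × A × Set γ × Q, ∀ n, ∃ i ≥ n,
        (ρ i, w i, κ i, ρ (i + 1)) = t ∧ c ∈ κ i := by
      refine exists_forall_of_forall_exists_antitone (fun m => ?_) ?_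
      · obtain ⟨i, hi, hc⟩ := h m
        exact ⟨_, i, hi, rfl, hc⟩
      · rintro q m n hmn ⟨i, hi, h⟩
        exact ⟨i, hmn.trans hi, h⟩
    refine ⟨t, Set.infinite_setOf_of_forall_exists_ge fun n => ?_, ?_⟩
    · obtain ⟨i, hi, h, -⟩ := ht n
      exact ⟨i, hi, h⟩
    · obtain ⟨i, hi, rfl, hc⟩ := ht 0
      exact hc

namespace BA

variable {Q A : Type} (M : BA Q A)

theorem SameSCC.refl (p : Q) : M.SameSCC p p := ⟨.refl, .refl⟩

variable {M}

theorem SameSCC.symm {p q : Q} (h : M.SameSCC p q) : M.SameSCC q p := ⟨h.2, h.1⟩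

theorem SameSCC.trans {p q r : Q} (h : M.SameSCC p q) (h' : M.SameSCC q r) : M.SameSCC p r :=
  ⟨Relation.ReflTransGen.trans h.1 h'.1, Relation.ReflTransGen.trans h'.2 h.2⟩

theorem IsSCC.sameSCC {C : Set Q} (hC : M.IsSCC C) {p q : Q} (hp : p ∈ C) (hq : q ∈ C) :
    M.SameSCC p q := ⟨hC.2.1 p hp q hq, hC.2.1 q hq p hp⟩

theorem IsSCC.mem_of_sameSCC {C : Set Q} (hC : M.IsSCC C) {p q : Q} (hp : p ∈ C)
    (hpq : M.SameSCC p q) : q ∈ C := by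
  refine hC.2.2 (insert q C) (Set.subset_insert ..) ?_ (Set.mem_insert ..)
  have key : ∀ x ∈ insert q C, M.SameSCC p x := by
    rintro x (rfl | hx)
    · exact hpq
    · exact hC.sameSCC hp hx
  exact fun x hx y hy => ((key x hx).symm.trans (key y hy)).1

variable (M) in
theorem isSCC_setOf_sameSCC (p : Q) : M.IsSCC {q | M.SameSCC p q} :=
  ⟨⟨p, SameSCC.refl M p⟩, fun _ hx _ hy => (hx.symm.trans hy).1,
    fun _ hD h q hq => ⟨h p (hD (SameSCC.refl M p)) q hq, h q hq p (hD (SameSCC.refl M p))⟩⟩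

theorem mem_detPart_of_sameSCC {p q : Q} (hp : p ∈ M.detPart) (h : M.SameSCC p q) :
    q ∈ M.detPart := by
  obtain ⟨C, h1, h2, h3, h4⟩ := hp
  exact ⟨C, h1, h2, h3, h1.1.mem_of_sameSCC h4 h⟩

theorem deltaSCC_subset_detPart {S : Set Q} (hS : S ⊆ M.detPart) (a : A) :
    M.deltaSCC S a ⊆ M.detPart := by
  rintro q ⟨p, hp, -, hpq⟩
  exact mem_detPart_of_sameSCC (hS hp) hpq

theorem deltaSCC_subset_deltaSet (S : Set Q) (a : A) : M.deltaSCC S a ⊆ M.deltaSet S a := by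
  rintro q ⟨p, hp, hd, -⟩
  exact ⟨p, hp, hd⟩

theorem deltaSet_mono {S T : Set Q} (h : S ⊆ T) (a : A) : M.deltaSet S a ⊆ M.deltaSet T a := by
  rintro q ⟨p, hp, hd⟩
  exact ⟨p, h hp, hd⟩

theorem deltaSCC_mono {S T : Set Q} (h : S ⊆ T) (a : A) : M.deltaSCC S a ⊆ M.deltaSCC T a := by
  rintro q ⟨p, hp, hd⟩
  exact ⟨p, h hp, hd⟩

theorem deltaFD_mono {S T : Set Q} (h : S ⊆ T) (a : A) : M.deltaFD S a ⊆ M.deltaFD T a := by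
  rintro q ⟨p, hp, hd⟩
  exact ⟨p, h hp, hd⟩

theorem deltaSCC_union (S T : Set Q) (a : A) :
    M.deltaSCC (S ∪ T) a = M.deltaSCC S a ∪ M.deltaSCC T a := by
  ext q
  constructor
  · rintro ⟨p, hp | hp, h⟩
    · exact Or.inl ⟨p, hp, h⟩
    · exact Or.inr ⟨p, hp, h⟩
  · rintro (h | h)
    · exact deltaSCC_mono Set.subset_union_left a h
    · exact deltaSCC_mono Set.subset_union_right a h

theorem deltaFD_union (S T : Set Q) (a : A) :
    M.deltaFD (S ∪ T) a = M.deltaFD S a ∪ M.deltaFD T a := by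
  ext q
  constructor
  · rintro ⟨p, hp | hp, h⟩
    · exact Or.inl ⟨p, hp, h⟩
    · exact Or.inr ⟨p, hp, h⟩
  · rintro (h | h)
    · exact deltaFD_mono Set.subset_union_left a h
    · exact deltaFD_mono Set.subset_union_right a h

theorem subsingleton_deltaSCC {S : Set Q} (hS : S ⊆ M.detPart) (hs : S.Subsingleton) (a : A) :
    (M.deltaSCC S a).Subsingleton := by
  rintro q ⟨p, hp, hd, hpq⟩ q' ⟨p', hp', hd', hpq'⟩
  obtain rfl := hs hp hp'
  obtain ⟨C, h1, h2, -, h4⟩ := hS hp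
  exact h2 p h4 a ⟨⟨p, rfl, hd⟩, h1.1.mem_of_sameSCC h4 hpq⟩
    ⟨⟨p, rfl, hd'⟩, h1.1.mem_of_sameSCC h4 hpq'⟩

theorem reach_of_path {w : ℕ → A} {ρ : ℕ → Q} {N : ℕ}
    (hρ : ∀ i ≥ N, (ρ i, w i, ρ (i + 1)) ∈ M.delta) {i j : ℕ} (hi : N ≤ i) (hij : i ≤ j) :
    M.Reach (ρ i) (ρ j) := by
  induction j, hij using Nat.le_induction with
  | base => exact .refl
  | succ j hj ih => exact .tail ih ⟨w j, hρ j (hi.trans hj)⟩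

/-- Every infinite path of a finite automaton ends up in one SCC and visits some state of it
infinitely often. -/
theorem exists_sameSCC_tail [Finite Q] {w : ℕ → A} {ρ : ℕ → Q} {N : ℕ}
    (hρ : ∀ i ≥ N, (ρ i, w i, ρ (i + 1)) ∈ M.delta) :
    ∃ k ≥ N, (∀ i ≥ k, M.SameSCC (ρ k) (ρ i)) ∧ ∀ n, ∃ i ≥ n, ρ i = ρ k := by
  obtain ⟨q, hq⟩ : ∃ q, ∀ n, ∃ i ≥ n, ρ i = q := by
    refine exists_forall_of_forall_exists_antitone (fun m => ⟨ρ m, m, le_rfl, rfl⟩) ?_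
    rintro q m n hmn ⟨i, hi, h⟩
    exact ⟨i, hmn.trans hi, h⟩
  obtain ⟨k, hk, rfl⟩ := hq N
  refine ⟨k, hk, fun i hi => ⟨reach_of_path hρ hk hi, ?_⟩, hq⟩
  obtain ⟨j, hj, hjk⟩ := hq i
  rw [← hjk]
  exact reach_of_path hρ (le_trans hk hi) hj

/-- The set of states reachable on the length-`i` prefix of `w`. -/
def reachSet (M : BA Q A) (w : ℕ → A) : ℕ → Set Q
  | 0 => M.init
  | i + 1 => M.deltaSet (reachSet M w i) (w i)

theorem mem_lang_of_tail {w : ℕ → A} (N : ℕ) (ρ : ℕ → Q) (h0 : ρ N ∈ M.reachSet w N)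
    (hρ : ∀ i ≥ N, (ρ i, w i, ρ (i + 1)) ∈ M.delta)
    (hF : ∀ n, ∃ i ≥ n, (ρ i, w i, ρ (i + 1)) ∈ M.F) : w ∈ M.lang := by
  induction N generalizing ρ with
  | zero =>
    exact ⟨ρ, ⟨h0, fun i => hρ i (Nat.zero_le i)⟩, Set.infinite_setOf_of_forall_exists_ge hF⟩
  | succ N ih =>
    obtain ⟨p, hp, hd⟩ := h0
    refine ih (Function.update ρ N p) (by rwa [Function.update_self]) (fun i hi => ?_)
      fun n => ?_
    · rw [Function.update_of_ne (show i + 1 ≠ N by omega)]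
      by_cases h : i = N
      · subst h; rwa [Function.update_self]
      · rw [Function.update_of_ne h]; exact hρ i (by omega)
    · obtain ⟨i, hi, h⟩ := hF (max n (N + 1))
      have := le_max_left n (N + 1)
      have := le_max_right n (N + 1)
      refine ⟨i, by omega, ?_⟩
      rwa [Function.update_of_ne (by omega), Function.update_of_ne (by omega)]

theorem Reach.exists_path {p q : Q} [Nonempty A] (h : M.Reach p q) :
    ∃ (n : ℕ) (ρ : ℕ → Q) (σ : ℕ → A), ρ 0 = p ∧ ρ n = q ∧
      ∀ i < n, (ρ i, σ i, ρ (i + 1)) ∈ M.delta := by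
  induction h with
  | refl => exact ⟨0, fun _ => p, fun _ => Classical.arbitrary A, rfl, rfl, fun i hi => by omega⟩
  | @tail b c _ hbc ih =>
    obtain ⟨n, ρ, σ, h0, hn, hd⟩ := ih
    obtain ⟨a, ha⟩ := hbc
    refine ⟨n + 1, Function.update ρ (n + 1) c, Function.update σ n a, ?_, ?_, fun i hi => ?_⟩
    · rwa [Function.update_of_ne (by omega)]
    · exact Function.update_self ..
    · rw [Function.update_of_ne (show i ≠ n + 1 by omega)]
      by_cases h : i = n
      · subst h; rw [Function.update_self, Function.update_self, hn]; exact ha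
      · rw [Function.update_of_ne h, Function.update_of_ne (by omega)]
        exact hd i (by omega)

/-- In an accepting inherently weak SCC every cycle is accepting. -/
theorem IsAccSCC.exists_mem_F_of_isCycleIn {C : Set Q} (hC : M.IsAccSCC C)
    (hw : M.InherentlyWeak C) {k : ℕ} {ρ : ℕ → Q} {σ : ℕ → A} (h : M.IsCycleIn C k ρ σ) :
    ∃ i < k, (ρ i, σ i, ρ (i + 1)) ∈ M.F := by
  rcases hw with hw | hw
  · exact hw k ρ σ h
  exfalso
  obtain ⟨hS, p, hp, a, q, hq, hpq⟩ := hC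
  have : Nonempty A := ⟨a⟩
  obtain ⟨n, τ, s, h0, hn, hd⟩ := Reach.exists_path (hS.2.1 q hq p hp)
  have hmem : ∀ i ≤ n, τ i ∈ C := by
    have hr : ∀ j ≤ n, ∀ i ≤ j, M.Reach (τ i) (τ j) := by
      intro j hj i hij
      induction j, hij using Nat.le_induction with
      | base => exact .refl
      | succ j hij ih => exact .tail (ih (by omega)) ⟨s j, hd j (by omega)⟩
    intro i hi
    refine hS.mem_of_sameSCC hq ⟨?_, ?_⟩
    · rw [← h0]; exact hr i hi 0 (by omega)
    · have h1 := hr n le_rfl i hi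
      rw [hn] at h1
      exact Relation.ReflTransGen.trans h1 (hS.2.1 p hp q hq)
  refine hw (n + 1) (Function.update τ (n + 1) q) (Function.update s n a)
    ⟨by omega, ?_, fun i hi => ?_⟩ n (by omega) ?_
  · rw [Function.update_self, Function.update_of_ne (by omega), h0]
  · rw [Function.update_of_ne (show i ≠ n + 1 by omega)]
    refine ⟨hmem i (by omega), ?_⟩
    by_cases h : i = n
    · subst h; rw [Function.update_self, Function.update_self, hn]; exact M.F_sub hpq
    · rw [Function.update_of_ne h, Function.update_of_ne (by omega)]
      exact hd i (by omega)
  · rw [Function.update_of_ne (by omega), Function.update_self, Function.update_self, hn]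
    exact hpq

/-- A path that stays in the weak part is accepting. -/
theorem exists_mem_F_of_path_weakPart [Finite Q] {w : ℕ → A} {ρ : ℕ → Q} {N : ℕ}
    (hρ : ∀ i ≥ N, (ρ i, w i, ρ (i + 1)) ∈ M.delta) (hW : ∀ i ≥ N, ρ i ∈ M.weakPart) (n : ℕ) :
    ∃ i ≥ n, (ρ i, w i, ρ (i + 1)) ∈ M.F := by
  obtain ⟨k, hk, hs, hinf⟩ := exists_sameSCC_tail hρ
  obtain ⟨C, h1, h2, h3⟩ := hW k hk
  obtain ⟨i, hi, hik⟩ := hinf (max n k)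
  obtain ⟨j, hj, hjk⟩ := hinf (i + 1)
  have := le_max_left n k
  have := le_max_right n k
  obtain ⟨d, hd, hF⟩ := h1.exists_mem_F_of_isCycleIn h2 (k := j - i) (ρ := fun d => ρ (i + d))
    (σ := fun d => w (i + d)) (by
      refine ⟨by omega, ?_, fun d hd => ⟨h1.1.mem_of_sameSCC h3 (hs _ (by omega)),
        hρ (i + d) (by omega)⟩⟩
      change ρ i = ρ (i + (j - i))
      rw [show i + (j - i) = j by omega]
      exact hik.trans hjk.symm)
  exact ⟨i + d, by omega, hF⟩

/-- Runs confined to the weak part die out on rejected words. -/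
theorem mem_lang_of_weak_layers [Finite Q] {w : ℕ → A} {N : ℕ} {X : ℕ → Set Q}
    (h0 : X N ⊆ M.reachSet w N)
    (hX : ∀ i ≥ N, X (i + 1) = M.deltaSet (X i) (w i) ∩ M.weakPart)
    (hne : ∀ i ≥ N, (X (i + 1)).Nonempty) : w ∈ M.lang := by
  have hsub : X (N + 1) ⊆ M.reachSet w (N + 1) := by
    rw [hX N le_rfl]
    exact Set.inter_subset_left.trans (deltaSet_mono h0 _)
  obtain ⟨ρ, hρ0, hρ⟩ := exists_path_of_nonempty_layers
    (fun i p q => (p, w i, q) ∈ M.delta ∧ q ∈ M.weakPart) X (N + 1)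
    (fun n hn => by
      obtain ⟨m, rfl⟩ := Nat.exists_eq_add_of_le' (show 1 ≤ n by omega)
      exact hne m (by omega))
    (fun n hn q hq => by
      rw [hX n (by omega)] at hq
      obtain ⟨⟨p, hp, hd⟩, hq⟩ := hq
      exact ⟨p, hp, hd, hq⟩)
  refine mem_lang_of_tail (N + 1) ρ (hsub hρ0) (fun i hi => (hρ i hi).1)
    (exists_mem_F_of_path_weakPart (N := N + 2) (fun i hi => (hρ i (by omega)).1)
      fun i hi => ?_)
  obtain ⟨m, rfl⟩ := Nat.exists_eq_add_of_le' (show 1 ≤ i by omega)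
  exact (hρ m (by omega)).2

/-- Runs confined to the deterministic part eventually avoid accepting transitions on rejected
words. -/
theorem exists_forall_deltaFD_eq_empty [Finite Q]
    (hF : ∀ p a q, (p, a, q) ∈ M.F → M.SameSCC p q) {w : ℕ → A} (hw : w ∉ M.lang) {N : ℕ}
    {X : ℕ → Set Q} (h0 : X N ⊆ M.reachSet w N) (hD : X N ⊆ M.detPart)
    (hX : ∀ i ≥ N, X (i + 1) = M.deltaSCC (X i) (w i)) :
    ∃ m ≥ N, ∀ i ≥ m, M.deltaFD (X i) (w i) = ∅ := by
  by_contra! hc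
  let T : Q → ℕ → Set Q := fun b n => Nat.rec {b} (fun d S => M.deltaSCC S (w (N + d))) n
  have hT : ∀ b n, T b (n + 1) = M.deltaSCC (T b n) (w (N + n)) := fun _ _ => rfl
  have hXT : ∀ n, ∀ q ∈ X (N + n), ∃ b ∈ X N, q ∈ T b n := by
    intro n
    induction n with
    | zero => exact fun q hq => ⟨q, hq, rfl⟩
    | succ n ih =>
      intro q hq
      rw [← Nat.add_assoc, hX (N + n) (by omega)] at hq
      obtain ⟨p, hp, hd⟩ := hq
      obtain ⟨b, hb, hpb⟩ := ih p hp
      exact ⟨b, hb, p, hpb, hd⟩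
  obtain ⟨b, hb⟩ : ∃ b, ∀ m, ∃ n ≥ m, b ∈ X N ∧ ∃ p ∈ T b n, ∃ q, (p, w (N + n), q) ∈ M.F := by
    refine exists_forall_of_forall_exists_antitone (fun m => ?_) ?_
    · obtain ⟨i, hi, q, p, hp, hq⟩ := hc (N + m) (by omega)
      obtain ⟨n, rfl⟩ := Nat.exists_eq_add_of_le (show N ≤ i by omega)
      obtain ⟨b, hb, hpb⟩ := hXT n p hp
      exact ⟨b, n, by omega, hb, p, hpb, q, hq.1⟩
    · rintro q m n hmn ⟨i, hi, h⟩
      exact ⟨i, hmn.trans hi, h⟩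
  have hbN : b ∈ X N := by
    obtain ⟨n, -, h, -⟩ := hb 0
    exact h
  have hTs : ∀ n, T b n ⊆ M.detPart ∧ (T b n).Subsingleton := by
    intro n
    induction n with
    | zero => exact ⟨Set.singleton_subset_iff.2 (hD hbN), Set.subsingleton_singleton⟩
    | succ n ih => exact ⟨deltaSCC_subset_detPart ih.1 _, subsingleton_deltaSCC ih.1 ih.2 _⟩
  have hTne : ∀ n d, (T b (n + d)).Nonempty → (T b n).Nonempty := by
    intro n d
    induction d with
    | zero => exact id
    | succ d ih =>
      rintro ⟨q, p, hp, -⟩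
      exact ih ⟨p, hp⟩
  have hne : ∀ n, (T b n).Nonempty := by
    intro n
    obtain ⟨m, hm, -, p, hp, -⟩ := hb n
    obtain ⟨d, rfl⟩ := Nat.exists_eq_add_of_le hm
    exact hTne n d ⟨p, hp⟩
  choose σ hσ using hne
  have hd : ∀ n, (σ n, w (N + n), σ (n + 1)) ∈ M.delta := by
    intro n
    obtain ⟨p, hp, hd, -⟩ := hσ (n + 1)
    rwa [(hTs n).2 hp (hσ n)] at hd
  refine hw (mem_lang_of_tail N (fun i => σ (i - N)) ?_ (fun i hi => ?_) fun n => ?_)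
  · have h := hσ 0
    simp only [Nat.sub_self]
    rw [show σ 0 = b from h]
    exact h0 hbN
  · obtain ⟨n, rfl⟩ := Nat.exists_eq_add_of_le hi
    have h := hd n
    simp only [show N + n - N = n by omega, show N + n + 1 - N = n + 1 by omega]
    exact h
  · obtain ⟨m, hm, -, p, hp, q, hq⟩ := hb n
    refine ⟨N + m, by omega, ?_⟩
    simp only [show N + m - N = m by omega, show N + m + 1 - N = m + 1 by omega]
    have h1 : p = σ m := (hTs m).2 hp (hσ m)
    have h2 : q = σ (m + 1) :=
      (hTs (m + 1)).2 ⟨p, hp, M.F_sub hq, hF _ _ _ hq⟩ (hσ (m + 1))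
    rwa [← h1, ← h2]

/-- `S` at time `i` is safe if no path from `S` inside one SCC ever uses a transition of `FD`. -/
def Safe (M : BA Q A) (w : ℕ → A) (i : ℕ) (S : Set Q) : Prop :=
  ∃ Y : ℕ → Set Q, S ⊆ Y i ∧ ∀ j ≥ i, M.deltaSCC (Y j) (w j) ⊆ Y (j + 1) ∧
    M.deltaFD (Y j) (w j) = ∅

theorem Safe.deltaFD_eq_empty {w : ℕ → A} {i : ℕ} {S : Set Q} (h : M.Safe w i S) :
    M.deltaFD S (w i) = ∅ := by
  obtain ⟨Y, h1, h2⟩ := h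
  exact Set.subset_empty_iff.1 ((deltaFD_mono h1 _).trans (h2 i le_rfl).2.subset)

theorem Safe.deltaSCC {w : ℕ → A} {i : ℕ} {S : Set Q} (h : M.Safe w i S) :
    M.Safe w (i + 1) (M.deltaSCC S (w i)) := by
  obtain ⟨Y, h1, h2⟩ := h
  exact ⟨Y, (deltaSCC_mono h1 _).trans (h2 i le_rfl).1, fun j hj => h2 j (by omega)⟩

theorem Safe.mono {w : ℕ → A} {i : ℕ} {S T : Set Q} (h : M.Safe w i T) (hST : S ⊆ T) :
    M.Safe w i S := by
  obtain ⟨Y, h1, h2⟩ := h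
  exact ⟨Y, hST.trans h1, h2⟩

theorem Safe.union {w : ℕ → A} {i : ℕ} {S T : Set Q} (hS : M.Safe w i S) (hT : M.Safe w i T) :
    M.Safe w i (S ∪ T) := by
  obtain ⟨Y, h1, h2⟩ := hS
  obtain ⟨Z, h3, h4⟩ := hT
  refine ⟨fun j => Y j ∪ Z j, Set.union_subset_union h1 h3, fun j hj => ⟨?_, ?_⟩⟩
  · rw [deltaSCC_union]
    exact Set.union_subset_union (h2 j hj).1 (h4 j hj).1
  · rw [deltaFD_union, (h2 j hj).2, (h4 j hj).2, Set.union_empty]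

variable (M) in
theorem safe_empty (w : ℕ → A) (i : ℕ) : M.Safe w i ∅ := by
  refine ⟨fun _ => ∅, subset_rfl, fun j _ => ⟨?_, ?_⟩⟩
  · rintro q ⟨p, hp, -⟩
    exact hp.elim
  · ext q
    simp [BA.deltaFD]

/-- What a transition of `elevTELA` guarantees. -/
theorem elevTELA_trans_spec {H CD SD BD CW BW H' CD' SD' BD' CW' BW' : Set Q} {a : A}
    {κ : Set (Fin 2)}
    (h : ((H, (CD, SD, BD), (CW, BW)), a, κ, (H', (CD', SD', BD'), (CW', BW'))) ∈
      (elevTELA M).trans) :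
    M.deltaFD SD a = ∅ ∧ H' = M.deltaSet H a ∧
    CD' = (H' ∩ M.detPart) \ SD' ∧ M.deltaSCC SD a ∩ M.detPart ⊆ SD' ∧
    ((0 ∉ κ ∧ BD' = M.deltaSCC BD a) ∨ (M.deltaSCC BD a ⊆ SD' ∧ BD' = CD')) ∧
    ((1 ∉ κ ∧ BW' = M.deltaSet BW a ∩ (H' ∩ M.weakPart)) ∨
      (M.deltaSet BW a ∩ (H' ∩ M.weakPart) = ∅ ∧ BW' = H' ∩ M.weakPart)) := by
  obtain ⟨H₁, CD₁, SD₁, BD₁, CW₁, BW₁, a₁, S₁, C₁, Bs, B₁, W₁, Ws, BW₁', colD, colW, h0, hS, hC,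
    hBs, hB, hW, hWs, hBW, hcW, h⟩ := h
  rcases h with ⟨hcD, h⟩ | ⟨-, hcD, h⟩
  all_goals
    simp only [Prod.mk.injEq] at h
    obtain ⟨⟨rfl, ⟨rfl, rfl, rfl⟩, rfl, rfl⟩, rfl, rfl, rfl, ⟨rfl, rfl, rfl⟩, rfl, rfl⟩ := h
    subst hW hWs hBs hcW hcD
  · refine ⟨h0, rfl, hC, hS.superset, ?_, ?_⟩
    · by_cases hb : M.deltaSCC BD a = ∅
      · right
        rw [if_pos hb] at hB
        exact ⟨by simp [hb], hB⟩
      · left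
        rw [if_neg hb] at hB
        refine ⟨?_, hB⟩
        rw [if_neg hb]
        split_ifs <;> simp
    · by_cases hb : M.deltaSet BW a ∩ (M.deltaSet H a ∩ M.weakPart) = ∅
      · right
        rw [if_pos hb] at hBW
        exact ⟨hb, hBW⟩
      · left
        rw [if_neg hb] at hBW
        refine ⟨?_, hBW⟩
        rw [if_neg hb]
        split_ifs <;> simp
  · refine ⟨h0, rfl, ?_, hS.superset.trans Set.subset_union_left, Or.inr ⟨?_, rfl⟩, ?_⟩
    · rw [hC, Set.sdiff_sdiff, ← Set.union_assoc, Set.union_self]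
    · by_cases hb : M.deltaSCC BD a = ∅
      · simp [hb]
      · rw [if_neg hb] at hB
        rw [hB]
        exact Set.subset_union_right
    · by_cases hb : M.deltaSet BW a ∩ (M.deltaSet H a ∩ M.weakPart) = ∅
      · right
        rw [if_pos hb] at hBW
        exact ⟨hb, hBW⟩
      · left
        rw [if_neg hb] at hBW
        refine ⟨?_, hBW⟩
        rw [if_neg hb]
        simp

/-- An accepting run eventually stays in the weak part or in the deterministic part. -/
theorem AccRun.exists_tail_subset [Finite Q]
    (helev : ∀ C, M.IsAccSCC C → M.InherentlyWeak C ∨ M.DetSCC C)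
    {w : ℕ → A} {ρ : ℕ → Q} (h : M.AccRun w ρ) :
    ∃ k, (∀ i ≥ k, M.SameSCC (ρ i) (ρ (i + 1))) ∧
      ((∀ i ≥ k, ρ i ∈ M.weakPart) ∨ (∀ i ≥ k, ρ i ∈ M.detPart)) := by
  obtain ⟨k, -, hs, -⟩ := exists_sameSCC_tail (N := 0) fun i _ => h.1.2 i
  obtain ⟨i, hi, hiF⟩ := h.2.exists_ge_of_setOf k
  have hacc : M.IsAccSCC {q | M.SameSCC (ρ k) q} :=
    ⟨M.isSCC_setOf_sameSCC _, _, hs i hi, _, _, hs (i + 1) (by omega), hiF⟩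
  refine ⟨k, fun i hi => (hs i hi).symm.trans (hs (i + 1) (by omega)), ?_⟩
  by_cases hw : M.InherentlyWeak {q | M.SameSCC (ρ k) q}
  · exact Or.inl fun i hi => ⟨_, hacc, hw, hs i hi⟩
  · exact Or.inr fun i hi => ⟨_, hacc, (helev _ hacc).resolve_left hw, hw, hs i hi⟩

theorem notMem_lang_of_mem_lang_elevTELA [Finite Q] [Finite A]
    (helev : ∀ C, M.IsAccSCC C → M.InherentlyWeak C ∨ M.DetSCC C) {w : ℕ → A}
    (hw : w ∈ (elevTELA M).lang) : w ∉ M.lang := by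
  rintro ⟨ρ, hρ⟩
  obtain ⟨τ, κ, ⟨hinit, htr⟩, hacc⟩ := hw
  change 0 ∈ TELA.infCols w τ κ ∧ 1 ∈ TELA.infCols w τ κ at hacc
  rw [TELA.mem_infCols_iff, TELA.mem_infCols_iff] at hacc
  obtain ⟨hacc0, hacc1⟩ := hacc
  have spec := fun i => elevTELA_trans_spec (htr i)
  have hH : ∀ i, ρ i ∈ (τ i).1 := by
    intro i
    induction i with
    | zero =>
      rw [show τ 0 = _ from hinit]
      exact hρ.1.1
    | succ i ih =>
      rw [(spec i).2.1]
      exact ⟨_, ih, hρ.1.2 i⟩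
  obtain ⟨k, hs, hW | hD⟩ := hρ.exists_tail_subset helev
  · obtain ⟨i, hi, hc⟩ := hacc1 k
    have hB : ∀ j ≥ i + 1, ρ j ∈ (τ j).2.2.2 := by
      intro j hj
      induction j, hj using Nat.le_induction with
      | base =>
        rcases (spec i).2.2.2.2.2 with ⟨h, -⟩ | ⟨-, h⟩
        · exact absurd hc h
        · rw [h]
          exact ⟨hH _, hW _ (by omega)⟩
      | succ j hj ih =>
        rcases (spec j).2.2.2.2.2 with ⟨-, h⟩ | ⟨-, h⟩
        · rw [h]
          exact ⟨⟨_, ih, hρ.1.2 j⟩, hH _, hW _ (by omega)⟩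
        · rw [h]
          exact ⟨hH _, hW _ (by omega)⟩
    obtain ⟨j, hj, hc⟩ := hacc1 (i + 1)
    rcases (spec j).2.2.2.2.2 with ⟨h, -⟩ | ⟨h, -⟩
    · exact h hc
    · exact (h.subset ⟨⟨_, hB j hj, hρ.1.2 j⟩, hH _, hW _ (by omega)⟩).elim
  · have hS : ∀ i ≥ k, ρ i ∉ (τ i).2.1.2.1 := by
      intro i hi hiS
      have hall : ∀ j ≥ i, ρ j ∈ (τ j).2.1.2.1 := by
        intro j hj
        induction j, hj using Nat.le_induction with
        | base => exact hiS
        | succ j hj ih =>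
          exact (spec j).2.2.2.1 ⟨⟨_, ih, hρ.1.2 j, hs j (by omega)⟩, hD _ (by omega)⟩
      obtain ⟨j, hj, hF⟩ := hρ.2.exists_ge_of_setOf i
      exact ((spec j).1.subset ⟨_, hall j hj, hF, hD _ (by omega), hD _ (by omega)⟩).elim
    have hC : ∀ i ≥ k, ρ (i + 1) ∈ (τ (i + 1)).2.1.1 := by
      intro i hi
      rw [(spec i).2.2.1]
      exact ⟨⟨hH _, hD _ (by omega)⟩, hS _ (by omega)⟩
    obtain ⟨i, hi, hc⟩ := hacc0 k
    have hB : ∀ j ≥ i + 1, ρ j ∈ (τ j).2.1.2.2 := by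
      intro j hj
      induction j, hj using Nat.le_induction with
      | base =>
        rcases (spec i).2.2.2.2.1 with ⟨h, -⟩ | ⟨-, h⟩
        · exact absurd hc h
        · rw [h]
          exact hC i hi
      | succ j hj ih =>
        rcases (spec j).2.2.2.2.1 with ⟨-, h⟩ | ⟨-, h⟩
        · rw [h]
          exact ⟨_, ih, hρ.1.2 j, hs j (by omega)⟩
        · rw [h]
          exact hC j (by omega)
    obtain ⟨j, hj, hc⟩ := hacc0 (i + 1)
    rcases (spec j).2.2.2.2.1 with ⟨h, -⟩ | ⟨h, -⟩
    · exact h hc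
    · exact hS (j + 1) (by omega) (h ⟨_, hB j hj, hρ.1.2 j, hs j (by omega)⟩)

/-- The invariant of the accepting run of `elevTELA` built on a rejected word. -/
def ElevInv (M : BA Q A) (w : ℕ → A) (i : ℕ)
    (s : Set Q × (Set Q × Set Q × Set Q) × (Set Q × Set Q)) : Prop :=
  s.1 = M.reachSet w i ∧ M.Safe w i s.2.1.2.1 ∧ s.2.1.2.2 ⊆ M.reachSet w i ∩ M.detPart ∧
    s.2.2.2 ⊆ M.reachSet w i

theorem ElevInv.exists_succ {w : ℕ → A} {i : ℕ}
    {s : Set Q × (Set Q × Set Q × Set Q) × (Set Q × Set Q)} (hs : M.ElevInv w i s) :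
    ∃ s' κ, M.ElevInv w (i + 1) s' ∧ (s, w i, κ, s') ∈ (elevTELA M).trans ∧
      (0 ∈ κ ∨ (¬ M.Safe w i s.2.1.2.2 ∧ s'.2.1.2.2 = M.deltaSCC s.2.1.2.2 (w i))) ∧
      (1 ∈ κ ∨ (s'.2.2.2 = M.deltaSet s.2.2.2 (w i) ∩ M.weakPart ∧ s'.2.2.2.Nonempty)) := by
  obtain ⟨H, ⟨CD, SD, BD⟩, CW, BW⟩ := s
  obtain ⟨hH, hS, hB, hW⟩ := hs
  dsimp only at hH hS hB hW ⊢
  subst hH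
  obtain ⟨SD', hSD'⟩ : ∃ X, X = M.deltaSCC SD (w i) ∩ M.detPart := ⟨_, rfl⟩
  obtain ⟨CD', hCD'⟩ : ∃ X, X = (M.deltaSet (M.reachSet w i) (w i) ∩ M.detPart) \ SD' := ⟨_, rfl⟩
  obtain ⟨BD', hBD'⟩ : ∃ X, X = if M.deltaSCC BD (w i) = ∅ then CD' else M.deltaSCC BD (w i) :=
    ⟨_, rfl⟩
  obtain ⟨CW', hCW'⟩ : ∃ X, X = M.deltaSet (M.reachSet w i) (w i) ∩ M.weakPart := ⟨_, rfl⟩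
  obtain ⟨BW', hBW'⟩ : ∃ X, X = if M.deltaSet BW (w i) ∩ CW' = ∅ then CW' else
    M.deltaSet BW (w i) ∩ CW' := ⟨_, rfl⟩
  have hCsub : CD' ⊆ M.reachSet w (i + 1) ∩ M.detPart := by
    rw [hCD']
    exact Set.sdiff_subset
  have hBsub : BD' ⊆ M.reachSet w (i + 1) ∩ M.detPart := by
    rw [hBD']
    split_ifs
    · exact hCsub
    · refine Set.subset_inter ?_ (deltaSCC_subset_detPart (hB.trans Set.inter_subset_right) _)
      exact (deltaSCC_subset_deltaSet _ _).trans
        (deltaSet_mono (hB.trans Set.inter_subset_left) _)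
  have hCWsub : CW' ⊆ M.reachSet w (i + 1) := by
    rw [hCW']
    exact Set.inter_subset_left
  have hBWsub : BW' ⊆ M.reachSet w (i + 1) := by
    rw [hBW']
    split_ifs
    · exact hCWsub
    · exact Set.inter_subset_right.trans hCWsub
  have hSafe : M.Safe w (i + 1) SD' := by
    rw [hSD']
    exact hS.deltaSCC.mono Set.inter_subset_left
  have hweak : ∀ colD : Set (Fin 2),
      1 ∈ colD ∪ (if M.deltaSet BW (w i) ∩ CW' = ∅ then ({1} : Set (Fin 2)) else ∅) ∨
      (BW' = M.deltaSet BW (w i) ∩ M.weakPart ∧ BW'.Nonempty) := by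
    intro colD
    by_cases hb : M.deltaSet BW (w i) ∩ CW' = ∅
    · left
      rw [if_pos hb]
      simp
    · right
      rw [if_neg hb] at hBW'
      refine ⟨?_, by rw [hBW']; exact Set.nonempty_iff_ne_empty.2 hb⟩
      rw [hBW', hCW', ← Set.inter_assoc, Set.inter_eq_left.2 (deltaSet_mono hW _)]
  by_cases hcase : M.Safe w i BD ∧ M.deltaSCC BD (w i) ≠ ∅
  · refine ⟨(M.deltaSet (M.reachSet w i) (w i),
      (CD' \ (SD' ∪ BD'), SD' ∪ BD', CD' \ (SD' ∪ BD')), (CW', BW')), _,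
      ⟨rfl, ?_, Set.sdiff_subset.trans hCsub, hBWsub⟩,
      ⟨_, CD, SD, BD, CW, BW, w i, SD', CD', _, BD', CW', _, BW', {0}, _,
        hS.deltaFD_eq_empty, hSD', hCD', rfl, hBD', hCW', rfl, hBW', rfl,
        Or.inr ⟨?_, rfl, rfl⟩⟩, Or.inl (Or.inl rfl), hweak _⟩
    · refine hSafe.union ?_
      rw [hBD', if_neg hcase.2]
      exact hcase.1.deltaSCC
    · rw [hcase.1.deltaFD_eq_empty, Set.empty_inter]
  · refine ⟨(M.deltaSet (M.reachSet w i) (w i), (CD', SD', BD'), (CW', BW')), _,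
      ⟨rfl, hSafe, hBsub, hBWsub⟩,
      ⟨_, CD, SD, BD, CW, BW, w i, SD', CD', _, BD', CW', _, BW', _, _,
        hS.deltaFD_eq_empty, hSD', hCD', rfl, hBD', hCW', rfl, hBW', rfl,
        Or.inl ⟨rfl, rfl⟩⟩, ?_, hweak _⟩
    by_cases hb : M.deltaSCC BD (w i) = ∅
    · left
      rw [if_pos hb]
      exact Or.inl rfl
    · right
      rw [if_neg hb] at hBD'
      exact ⟨fun h => hcase ⟨h, hb⟩, hBD'⟩

theorem mem_lang_elevTELA_of_notMem_lang [Finite Q] [Finite A]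
    (hF : ∀ p a q, (p, a, q) ∈ M.F → M.SameSCC p q) {w : ℕ → A} (hw : w ∉ M.lang) :
    w ∈ (elevTELA M).lang := by
  have hstep : ∀ i s, M.ElevInv w i s → _ := fun i s hs => hs.exists_succ
  choose! nxt col hnxt using hstep
  let s₀ : Set Q × (Set Q × Set Q × Set Q) × (Set Q × Set Q) :=
    (M.init, (M.init ∩ M.detPart, ∅, M.init ∩ M.detPart),
      (M.init ∩ M.weakPart, M.init ∩ M.weakPart))
  let τ : ℕ → Set Q × (Set Q × Set Q × Set Q) × (Set Q × Set Q) :=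
    fun n => Nat.rec s₀ (fun i s => nxt i s) n
  have hinv : ∀ i, M.ElevInv w i (τ i) := by
    intro i
    induction i with
    | zero => exact ⟨rfl, M.safe_empty w 0, subset_rfl, Set.inter_subset_left⟩
    | succ i ih => exact (hnxt i _ ih).1
  have hτ := fun i => (hnxt i _ (hinv i)).2
  refine ⟨τ, fun i => col i (τ i), ⟨rfl, fun i => (hτ i).1⟩, ?_⟩
  change 0 ∈ TELA.infCols w τ _ ∧ 1 ∈ TELA.infCols w τ _
  rw [TELA.mem_infCols_iff, TELA.mem_infCols_iff]
  constructor
  · by_contra! hc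
    obtain ⟨N, hN⟩ := hc
    have hB := fun i hi => (hτ i).2.1.resolve_left (hN i hi)
    have hNB := (hinv N).2.2.1
    obtain ⟨m, hm, hempty⟩ := exists_forall_deltaFD_eq_empty hF hw
      (X := fun i => (τ i).2.1.2.2) (hNB.trans Set.inter_subset_left)
      (hNB.trans Set.inter_subset_right) (fun i hi => (hB i hi).2)
    exact (hB m hm).1 ⟨fun i => (τ i).2.1.2.2, subset_rfl, fun j hj =>
      ⟨(hB j (le_trans hm hj)).2.superset, hempty j hj⟩⟩
  · by_contra! hc
    obtain ⟨N, hN⟩ := hc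
    have hB := fun i hi => (hτ i).2.2.resolve_left (hN i hi)
    exact hw (mem_lang_of_weak_layers (X := fun i => (τ i).2.2.2) (hinv N).2.2.2
      (fun i hi => (hB i hi).1) (fun i hi => (hB i hi).2))

end BA

theorem statement5 {Q A : Type} [Fintype Q] [Fintype A] [Nonempty A]
    (M : BA Q A) (hcompl : M.Complete)
    (helev : ∀ C, M.IsAccSCC C → M.InherentlyWeak C ∨ M.DetSCC C)
    (hF : ∀ p a q, (p, a, q) ∈ M.F → ∃ C, M.IsSCC C ∧ p ∈ C ∧ q ∈ C) :
    (elevTELA M).lang = (M.lang)ᶜ := by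
  have hF' : ∀ p a q, (p, a, q) ∈ M.F → M.SameSCC p q := fun p a q h => by
    obtain ⟨C, hC, hp, hq⟩ := hF p a q h
    exact hC.sameSCC hp hq
  exact Set.Subset.antisymm (fun _ hw => BA.notMem_lang_of_mem_lang_elevTELA helev hw)
    fun _ hw => BA.mem_lang_elevTELA_of_notMem_lang hF' hw
end

section
/- Let A be a complete BA over Σ, P_1, …, P_n a partitioning of A, and for each i let alg^i_{P_i} be a partial complementation instance for P_i satisfying L(ModCompl(alg^i_{P_i}, A_{P_i})) = Σ^ω \ L(A_{P_i}). Then the intersection over i = 1, …, n of the languages L(ModCompl(alg^i_{P_i}, A_{P_i})) equals Σ^ω \ L(A); consequently, the postponed construction (any TELA whose language is this intersection, e.g., a product of language-preserving reductions of the ModCompl(alg^i_{P_i}, A_{P_i})) accepts Σ^ω \ L(A). -/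
attribute [local instance] Classical.propDecidable

universe u v w y

namespace BA

variable {Q : Type u} {A : Type v}

theorem IsRun.reach {M : BA Q A} {w : ℕ → A} {ρ : ℕ → Q} (h : M.IsRun w ρ) {i j : ℕ}
    (hij : i ≤ j) : M.Reach (ρ i) (ρ j) := by
  induction j, hij using Nat.le_induction with
  | base => exact Relation.ReflTransGen.refl
  | succ j _ ih => exact ih.tail ⟨w j, h.2 j⟩

theorem isSCC_sameSCC (M : BA Q A) (p : Q) : M.IsSCC {r | M.SameSCC p r} := by
  refine ⟨⟨p, .refl, .refl⟩, fun r hr s hs => hr.2.trans hs.1, fun D hD hR r hr => ?_⟩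
  have hp : p ∈ D := hD ⟨.refl, .refl⟩
  exact ⟨hR p hp r hr, hR r hr p hp⟩

/-- Some accepting transition of an accepting run of a finite automaton recurs. -/
theorem AccRun.exists_recurring [Finite Q] [Finite A] {M : BA Q A} {w : ℕ → A} {ρ : ℕ → Q}
    (h : M.AccRun w ρ) : ∃ t ∈ M.F, {i | (ρ i, w i, ρ (i + 1)) = t}.Infinite := by
  by_contra! hfin
  refine h.2 (((Set.toFinite M.F).biUnion hfin).subset fun i hi => ?_)
  exact Set.mem_biUnion hi rfl

/-- Restricting the accepting transitions to a block shrinks the language. -/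
theorem lang_restrict_subset (M : BA Q A) (P : Set Q) : (M.restrict P).lang ⊆ M.lang := by
  rintro w ⟨ρ, hrun, hinf⟩
  exact ⟨ρ, hrun, hinf.mono fun i hi => hi.1⟩

/-- A finite automaton accepts the union of the languages of its restrictions to the blocks of
a partitioning. -/
theorem lang_eq_iUnion_restrict [Finite Q] [Finite A] {n : ℕ} {M : BA Q A} {P : Fin n → Set Q}
    (hP : IsPartitioning M P) : M.lang = ⋃ i, (M.restrict (P i)).lang := by
  refine Set.Subset.antisymm ?_ (Set.iUnion_subset fun i => M.lang_restrict_subset (P i))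
  rintro w ⟨ρ, h⟩
  obtain ⟨⟨p, a, q⟩, htF, hinf⟩ := h.exists_recurring
  have hpq : M.SameSCC p q := by
    obtain ⟨i, hi⟩ := hinf.nonempty
    obtain ⟨j, hj, hij⟩ := hinf.exists_gt i
    simp only [Set.mem_ofPred_eq, Prod.mk.injEq] at hi hj
    refine ⟨.single ⟨a, M.F_sub htF⟩, ?_⟩
    rw [← hi.2.2, ← hj.1]
    exact h.1.reach hij
  have hp : M.SameSCC p p := ⟨.refl, .refl⟩
  obtain ⟨i, hi⟩ := hP.2.2 {r | M.SameSCC p r} ⟨M.isSCC_sameSCC p, p, hp, a, q, hpq, htF⟩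
  refine Set.mem_iUnion.mpr ⟨i, ρ, h.1, hinf.mono fun k hk => ?_⟩
  change (ρ k, w k, ρ (k + 1)) = (p, a, q) at hk
  change (ρ k, w k, ρ (k + 1)) ∈ (M.restrict (P i)).F
  rw [hk]
  exact ⟨htF, hi hp, hi hpq⟩

end BA

theorem statement8 {Q A : Type} [Fintype Q] [Fintype A] [Nonempty A] {n : ℕ}
    {T : Fin (n + 1) → Type} {γ : Fin (n + 1) → Type} [∀ i, Finite (γ i)]
    (M : BA Q A) (hcompl : M.Complete)
    (P : Fin (n + 1) → Set Q) (hP : IsPartitioning M P)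
    (alg : ∀ i, PartialAlg Q A (T i) (γ i))
    (halg : ∀ i, (ModCompl1 (M.restrict (P i)) (alg i)).lang
                   = ((M.restrict (P i)).lang)ᶜ) :
    (⋂ i, (ModCompl1 (M.restrict (P i)) (alg i)).lang) = (M.lang)ᶜ ∧
    ∀ (Q' γ' : Type) (C : TELA Q' A γ'),
      C.lang = (⋂ i, (ModCompl1 (M.restrict (P i)) (alg i)).lang) →
      C.lang = (M.lang)ᶜ := by
  have key : (⋂ i, (ModCompl1 (M.restrict (P i)) (alg i)).lang) = (M.lang)ᶜ := by
    rw [BA.lang_eq_iUnion_restrict hP, Set.compl_iUnion]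
    exact Set.iInter_congr halg
  exact ⟨key, fun _ _ _ hC => hC.trans key⟩
end
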